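/- Let S₁, S₂ be right admissible subcategories of a triangulated category T with Hom_T(S₂, S₁) = 0 (i.e. Hom(S₂, S₁) = 0 for all S₂ ∈ S₂, S₁ ∈ S₁). Then the triangulated envelope tria(S₁ ∪ S₂) of S₁ ∪ S₂ in T is a right admissible subcategory of T. Dually, if S₁ and S₂ are left admissible with Hom_T(S₂, S₁) = 0, then tria(S₁ ∪ S₂) is left admissible in T. -/

import Mathlib

open CategoryTheory CategoryTheory.Limits CategoryTheory.Pretriangulated ZeroObject

universe w v u

variable {T : Type u} [Category.{v} T] [HasZeroObject T] [HasShift T ℤ]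
  [Preadditive T] [∀ n : ℤ, (shiftFunctor T n).Additive] [Pretriangulated T]

namespace SOD

/-- `Hom_T(V, U) = 0`: every morphism from an object of `V` to an object of `U` is zero. -/
def ZeroHoms (V U : Set T) : Prop :=
  ∀ ⦃X Y : T⦄, X ∈ V → Y ∈ U → ∀ f : X ⟶ Y, f = 0

/-- The right orthogonal `S^⊥` of a subcategory `S`. -/
def rightOrthogonal (S : Set T) : Set T :=
  {Y | ∀ ⦃X : T⦄, X ∈ S → ∀ f : X ⟶ Y, f = 0}

/-- The left orthogonal `^⊥S` of a subcategory `S`. -/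
def leftOrthogonal (S : Set T) : Set T :=
  {X | ∀ ⦃Y : T⦄, Y ∈ S → ∀ f : X ⟶ Y, f = 0}

/-- A strict full triangulated subcategory of `T`, encoded by its class of objects. -/
structure IsTriangulatedSub (S : Set T) : Prop where
  mem_of_iso : ∀ {X Y : T}, (X ≅ Y) → X ∈ S → Y ∈ S
  zero_mem : (0 : T) ∈ S
  shift_mem : ∀ (X : T) (n : ℤ), X ∈ S → X⟦n⟧ ∈ S
  ext₂ : ∀ (Tr : Triangle T), (Tr ∈ distTriang T) → Tr.obj₁ ∈ S → Tr.obj₃ ∈ S → Tr.obj₂ ∈ S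

/-- `S` is right admissible: it is a strict full triangulated subcategory and every
object `A` fits in a distinguished triangle `A_S → A → A' → A_S⟦1⟧` with `A_S ∈ S` and
`A' ∈ S^⊥`. -/
def IsRightAdmissible (S : Set T) : Prop :=
  IsTriangulatedSub S ∧
  ∀ A : T, ∃ (B C : T) (f : B ⟶ A) (g : A ⟶ C) (h : C ⟶ B⟦(1 : ℤ)⟧),
    (Triangle.mk f g h ∈ distTriang T) ∧ B ∈ S ∧ C ∈ rightOrthogonal S

/-- `S` is left admissible: it is a strict full triangulated subcategory and every
object `A` fits in a distinguished triangle `A'' → A → A_S → A''⟦1⟧` with `A'' ∈ ^⊥S`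
and `A_S ∈ S`. -/
def IsLeftAdmissible (S : Set T) : Prop :=
  IsTriangulatedSub S ∧
  ∀ A : T, ∃ (B C : T) (f : B ⟶ A) (g : A ⟶ C) (h : C ⟶ B⟦(1 : ℤ)⟧),
    (Triangle.mk f g h ∈ distTriang T) ∧ B ∈ leftOrthogonal S ∧ C ∈ S

/-- The triangulated envelope of a class of objects: the smallest strict full
triangulated subcategory containing it. -/
inductive triaClosure (E : Set T) : T → Prop
  | of {X : T} : X ∈ E → triaClosure E X
  | zero : triaClosure E 0
  | iso {X Y : T} (e : X ≅ Y) : triaClosure E X → triaClosure E Y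
  | shift (X : T) (n : ℤ) : triaClosure E X → triaClosure E (X⟦n⟧)
  | ext₂ (Tr : Triangle T) (hTr : Tr ∈ distTriang T) :
      triaClosure E Tr.obj₁ → triaClosure E Tr.obj₃ → triaClosure E Tr.obj₂

end SOD

namespace SOD

/-- A replacement for the octahedral axiom: if `X` has no nonzero morphism to the cone of
`γ : B₁ ⟶ C`, it has none to the cone of a suitable morphism `B ⟶ A`, where `A` is an extension
of `C` by `B₂` and `B` is the induced extension of `B₁` by `B₂`. -/
lemma exists_triangle_of_hom_cone_eq_zero {A B₁ B₂ C C' : T}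
    {f : B₂ ⟶ A} {g : A ⟶ C} {h : C ⟶ B₂⟦(1 : ℤ)⟧} (hA : Triangle.mk f g h ∈ distTriang T)
    {γ : B₁ ⟶ C} {k : C ⟶ C'} {l : C' ⟶ B₁⟦(1 : ℤ)⟧} (hC : Triangle.mk γ k l ∈ distTriang T) :
    ∃ (B D : T) (a : B₂ ⟶ B) (b : B ⟶ B₁) (φ : B ⟶ A) (q : A ⟶ D) (r : D ⟶ B⟦(1 : ℤ)⟧),
      Triangle.mk a b (γ ≫ h) ∈ distTriang T ∧ Triangle.mk φ q r ∈ distTriang T ∧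
      ∀ X : T, (∀ u : X ⟶ C', u = 0) → ∀ u : X ⟶ D, u = 0 := by
  obtain ⟨B, a, b, hB⟩ := distinguished_cocone_triangle₂ (γ ≫ h)
  obtain ⟨φ, hφ₁, hφ₂⟩ : ∃ φ : B ⟶ A, a ≫ φ = 𝟙 B₂ ≫ f ∧ b ≫ γ = φ ≫ g :=
    complete_distinguished_triangle_morphism₂ _ _ hB hA (𝟙 B₂) γ (by
      change (γ ≫ h) ≫ (𝟙 B₂)⟦(1 : ℤ)⟧' = γ ≫ h
      rw [CategoryTheory.Functor.map_id, Category.comp_id])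
  rw [Category.id_comp] at hφ₁
  obtain ⟨D, q, r, hD⟩ := distinguished_cocone_triangle φ
  refine ⟨B, D, a, b, φ, q, r, hB, hD, fun X hX u ↦ ?_⟩
  have zB : (γ ≫ h) ≫ a⟦(1 : ℤ)⟧' = 0 := comp_distTriang_mor_zero₃₁ _ hB
  have zA : g ≫ h = 0 := comp_distTriang_mor_zero₂₃ _ hA
  have zD : φ ≫ q = 0 := comp_distTriang_mor_zero₁₂ _ hD
  have zD' : r ≫ φ⟦(1 : ℤ)⟧' = 0 := comp_distTriang_mor_zero₃₁ _ hD
  have injective : ∀ β : X ⟶ B⟦(1 : ℤ)⟧, β ≫ φ⟦(1 : ℤ)⟧' = 0 → β = 0 := by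
    intro β hβ
    have hb : β ≫ b⟦(1 : ℤ)⟧' = 0 := by
      obtain ⟨y, hy⟩ : ∃ y : X ⟶ C', β ≫ b⟦(1 : ℤ)⟧' = y ≫ l :=
        Triangle.coyoneda_exact₁ _ hC (β ≫ b⟦(1 : ℤ)⟧') (by
          change (β ≫ b⟦(1 : ℤ)⟧') ≫ γ⟦(1 : ℤ)⟧' = 0
          rw [Category.assoc, ← Functor.map_comp, hφ₂, Functor.map_comp, reassoc_of% hβ,
            zero_comp])
      rw [hy, hX y, zero_comp]
    obtain ⟨x, rfl⟩ : ∃ x : X ⟶ B₂⟦(1 : ℤ)⟧, β = x ≫ (-a⟦(1 : ℤ)⟧') :=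
      Triangle.coyoneda_exact₃ _ (rot_of_distTriang _ (rot_of_distTriang _ hB)) β (by
        change β ≫ (-b⟦(1 : ℤ)⟧') = 0
        rw [Preadditive.comp_neg, hb, neg_zero])
    obtain ⟨y, rfl⟩ : ∃ y : X ⟶ C, x = y ≫ h :=
      Triangle.coyoneda_exact₁ _ hA x (by
        change x ≫ f⟦(1 : ℤ)⟧' = 0
        rw [← hφ₁, Functor.map_comp]
        simpa using hβ)
    obtain ⟨z, rfl⟩ : ∃ z : X ⟶ B₁, y = z ≫ γ := Triangle.coyoneda_exact₂ _ hC y (hX _)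
    simpa using z ≫= zB
  have surjective : ∀ α : X ⟶ A, ∃ β : X ⟶ B, α = β ≫ φ := by
    intro α
    obtain ⟨z, hz⟩ : ∃ z : X ⟶ B₁, α ≫ g = z ≫ γ :=
      Triangle.coyoneda_exact₂ _ hC (α ≫ g) (hX _)
    obtain ⟨β, rfl⟩ : ∃ β : X ⟶ B, z = β ≫ b := Triangle.coyoneda_exact₃ _ hB z (by
      change z ≫ γ ≫ h = 0
      rw [← reassoc_of% hz, zA, comp_zero])
    obtain ⟨x, hx⟩ : ∃ x : X ⟶ B₂, α - β ≫ φ = x ≫ f :=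
      Triangle.coyoneda_exact₂ _ hA (α - β ≫ φ) (by
        change (α - β ≫ φ) ≫ g = 0
        rw [Preadditive.sub_comp, hz, Category.assoc, Category.assoc, hφ₂, sub_self])
    exact ⟨β + x ≫ a, by
      rw [Preadditive.add_comp, Category.assoc, hφ₁, ← hx, add_sub_cancel]⟩
  obtain ⟨α, rfl⟩ : ∃ α : X ⟶ A, u = α ≫ q := Triangle.coyoneda_exact₃ _ hD u
    (injective (u ≫ r) (by rw [Category.assoc, zD', comp_zero]))
  obtain ⟨β, rfl⟩ := surjective α
  rw [Category.assoc, zD, comp_zero]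

/-- The dual of `exists_triangle_of_hom_cone_eq_zero`: if the fibre of `p : B ⟶ C₂` has no nonzero
morphism to `Y`, neither has the fibre of a suitable morphism `A ⟶ D`, where `A` is an extension
of `C₁` by `B` and `D` is the induced extension of `C₁` by `C₂`. -/
lemma exists_triangle_of_hom_fibre_eq_zero {A B B' C₁ C₂ : T}
    {f : B ⟶ A} {g : A ⟶ C₁} {h : C₁ ⟶ B⟦(1 : ℤ)⟧} (hA : Triangle.mk f g h ∈ distTriang T)
    {k : B' ⟶ B} {p : B ⟶ C₂} {l : C₂ ⟶ B'⟦(1 : ℤ)⟧} (hB : Triangle.mk k p l ∈ distTriang T) :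
    ∃ (D E : T) (a : C₂ ⟶ D) (b : D ⟶ C₁) (e : E ⟶ A) (φ : A ⟶ D) (w : D ⟶ E⟦(1 : ℤ)⟧),
      Triangle.mk a b (h ≫ p⟦(1 : ℤ)⟧') ∈ distTriang T ∧ Triangle.mk e φ w ∈ distTriang T ∧
      ∀ Y : T, (∀ u : B' ⟶ Y, u = 0) → ∀ u : E ⟶ Y, u = 0 := by
  obtain ⟨D, a, b, hD⟩ := distinguished_cocone_triangle₂ (h ≫ p⟦(1 : ℤ)⟧')
  obtain ⟨φ, hφ₁, hφ₂⟩ : ∃ φ : A ⟶ D, f ≫ φ = p ≫ a ∧ g ≫ 𝟙 C₁ = φ ≫ b :=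
    complete_distinguished_triangle_morphism₂ _ _ hA hD p (𝟙 C₁) (Category.id_comp _).symm
  rw [Category.comp_id] at hφ₂
  obtain ⟨E, e, w, hE⟩ := distinguished_cocone_triangle₁ φ
  refine ⟨D, E, a, b, e, φ, w, hD, hE, fun Y hY u ↦ ?_⟩
  have zD : b ≫ h ≫ p⟦(1 : ℤ)⟧' = 0 := comp_distTriang_mor_zero₂₃ _ hD
  have zA : h ≫ f⟦(1 : ℤ)⟧' = 0 := comp_distTriang_mor_zero₃₁ _ hA
  have zE : φ ≫ w = 0 := comp_distTriang_mor_zero₂₃ _ hE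
  have hY' : ∀ v : B'⟦(1 : ℤ)⟧ ⟶ Y⟦(1 : ℤ)⟧, v = 0 := fun v ↦ by
    obtain ⟨v, rfl⟩ := (shiftFunctor T (1 : ℤ)).map_surjective v
    rw [hY v, Functor.map_zero]
  have factors : ∀ v : B⟦(1 : ℤ)⟧ ⟶ Y⟦(1 : ℤ)⟧, ∃ z : C₂⟦(1 : ℤ)⟧ ⟶ Y⟦(1 : ℤ)⟧,
      v = p⟦(1 : ℤ)⟧' ≫ z := by
    intro v
    obtain ⟨v, rfl⟩ := (shiftFunctor T (1 : ℤ)).map_surjective v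
    obtain ⟨z, rfl⟩ : ∃ z : C₂ ⟶ Y, v = p ≫ z := Triangle.yoneda_exact₂ _ hB v (hY _)
    exact ⟨z⟦(1 : ℤ)⟧', Functor.map_comp _ _ _⟩
  have injective : ∀ β : D ⟶ Y⟦(1 : ℤ)⟧, φ ≫ β = 0 → β = 0 := by
    intro β hβ
    have ha : a ≫ β = 0 := by
      obtain ⟨y, hy⟩ : ∃ y : B'⟦(1 : ℤ)⟧ ⟶ Y⟦(1 : ℤ)⟧, a ≫ β = l ≫ y :=
        Triangle.yoneda_exact₃ _ hB (a ≫ β) (by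
          change p ≫ a ≫ β = 0
          rw [← reassoc_of% hφ₁, hβ, comp_zero])
      rw [hy, hY' y, comp_zero]
    obtain ⟨x, rfl⟩ : ∃ x : C₁ ⟶ Y⟦(1 : ℤ)⟧, β = b ≫ x := Triangle.yoneda_exact₂ _ hD β ha
    obtain ⟨y, rfl⟩ : ∃ y : B⟦(1 : ℤ)⟧ ⟶ Y⟦(1 : ℤ)⟧, x = h ≫ y :=
      Triangle.yoneda_exact₃ _ hA x (by
        change g ≫ x = 0
        rw [hφ₂, Category.assoc, hβ])
    obtain ⟨z, rfl⟩ := factors y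
    rw [reassoc_of% zD, zero_comp]
  have surjective : ∀ α : A⟦(1 : ℤ)⟧ ⟶ Y⟦(1 : ℤ)⟧,
      ∃ β : D⟦(1 : ℤ)⟧ ⟶ Y⟦(1 : ℤ)⟧, α = φ⟦(1 : ℤ)⟧' ≫ β := by
    intro α
    obtain ⟨z, hz⟩ := factors (f⟦(1 : ℤ)⟧' ≫ α)
    obtain ⟨β, rfl⟩ : ∃ β : D⟦(1 : ℤ)⟧ ⟶ Y⟦(1 : ℤ)⟧, z = (-a⟦(1 : ℤ)⟧') ≫ β :=
      Triangle.yoneda_exact₃ _ (rot_of_distTriang _ hD) z (by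
        change (h ≫ p⟦(1 : ℤ)⟧') ≫ z = 0
        rw [Category.assoc, ← hz, reassoc_of% zA, zero_comp])
    have hφ₁' : f⟦(1 : ℤ)⟧' ≫ φ⟦(1 : ℤ)⟧' = p⟦(1 : ℤ)⟧' ≫ a⟦(1 : ℤ)⟧' := by
      rw [← Functor.map_comp, hφ₁, Functor.map_comp]
    obtain ⟨x, hx⟩ : ∃ x : C₁⟦(1 : ℤ)⟧ ⟶ Y⟦(1 : ℤ)⟧,
        α + φ⟦(1 : ℤ)⟧' ≫ β = (-g⟦(1 : ℤ)⟧') ≫ x :=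
      Triangle.yoneda_exact₃ _ (rot_of_distTriang _ (rot_of_distTriang _ hA))
        (α + φ⟦(1 : ℤ)⟧' ≫ β) (by
          change (-f⟦(1 : ℤ)⟧') ≫ (α + φ⟦(1 : ℤ)⟧' ≫ β) = 0
          simp [hz, reassoc_of% hφ₁'])
    refine ⟨-(b⟦(1 : ℤ)⟧' ≫ x) - β, ?_⟩
    rw [← sub_eq_iff_eq_add.mpr hx.symm, hφ₂]
    simp
  suffices u⟦(1 : ℤ)⟧' = 0 from (shiftFunctor T (1 : ℤ)).map_injective (by simpa using this)
  obtain ⟨α, hα⟩ : ∃ α : A⟦(1 : ℤ)⟧ ⟶ Y⟦(1 : ℤ)⟧, u⟦(1 : ℤ)⟧' = (-e⟦(1 : ℤ)⟧') ≫ α :=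
    Triangle.yoneda_exact₃ _ (rot_of_distTriang _ hE) (u⟦(1 : ℤ)⟧')
      (injective (w ≫ u⟦(1 : ℤ)⟧') (by rw [reassoc_of% zE, zero_comp]))
  obtain ⟨β, rfl⟩ := surjective α
  have zE' : e⟦(1 : ℤ)⟧' ≫ φ⟦(1 : ℤ)⟧' = 0 := by
    rw [← Functor.map_comp, show e ≫ φ = 0 from comp_distTriang_mor_zero₁₂ _ hE,
      Functor.map_zero]
  rw [hα, Preadditive.neg_comp, reassoc_of% zE', zero_comp, neg_zero]

lemma isTriangulatedSub_triaClosure (E : Set T) : IsTriangulatedSub {X | triaClosure E X} where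
  mem_of_iso e h := .iso e h
  zero_mem := .zero
  shift_mem X n h := .shift X n h
  ext₂ Tr hTr h₁ h₃ := .ext₂ Tr hTr h₁ h₃

lemma triaClosure_le {E : Set T} (P : ObjectProperty T) [P.IsTriangulated]
    [P.IsClosedUnderIsomorphisms] (hE : ∀ X ∈ E, P X) {X : T} (hX : triaClosure E X) : P X := by
  induction hX with
  | of h => exact hE _ h
  | zero => exact P.prop_zero
  | iso e _ h => exact P.prop_of_iso e h
  | shift X n _ h => exact P.le_shift n _ h
  | ext₂ Tr hTr _ _ h₁ h₃ => exact P.ext_of_isTriangulatedClosed₂ Tr hTr h₁ h₃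

/-- The object property corresponding to a class of objects. -/
def objectProperty (S : Set T) : ObjectProperty T := fun X ↦ X ∈ S

lemma isStableUnderShift_objectProperty {C : Type*} [Category* C] [HasShift C ℤ] {S : Set C}
    (hS : ∀ (X : C) (n : ℤ), X ∈ S → X⟦n⟧ ∈ S) : (objectProperty S).IsStableUnderShift ℤ where
  isStableUnderShiftBy n := ⟨fun X hX ↦ hS X n hX⟩

lemma mem_rightOrthogonal_triaClosure {E : Set T} (hE : ∀ (X : T) (n : ℤ), X ∈ E → X⟦n⟧ ∈ E)
    {Y : T} (hY : Y ∈ rightOrthogonal E) : Y ∈ rightOrthogonal {X | triaClosure E X} := by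
  have := isStableUnderShift_objectProperty hE
  intro X hX f
  exact triaClosure_le (objectProperty E).rightOrthogonal.leftOrthogonal
    (fun X hX Y f hY ↦ hY f hX) hX f (fun _ g hZ ↦ hY hZ g)

lemma mem_leftOrthogonal_triaClosure {E : Set T} (hE : ∀ (X : T) (n : ℤ), X ∈ E → X⟦n⟧ ∈ E)
    {X : T} (hX : X ∈ leftOrthogonal E) : X ∈ leftOrthogonal {Y | triaClosure E Y} := by
  have := isStableUnderShift_objectProperty hE
  intro Y hY f
  exact triaClosure_le (objectProperty E).leftOrthogonal.rightOrthogonal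
    (fun Y hY X f hX ↦ hX f hY) hY f (fun _ g hZ ↦ hX hZ g)

lemma IsTriangulatedSub.shift_mem_union {S₁ S₂ : Set T} (h₁ : IsTriangulatedSub S₁)
    (h₂ : IsTriangulatedSub S₂) (X : T) (n : ℤ) (hX : X ∈ S₁ ∪ S₂) : X⟦n⟧ ∈ S₁ ∪ S₂ :=
  hX.imp (h₁.shift_mem X n) (h₂.shift_mem X n)

lemma IsRightAdmissible.triaClosure_union {S₁ S₂ : Set T} (horth : ZeroHoms S₂ S₁)
    (h₁ : IsRightAdmissible S₁) (h₂ : IsRightAdmissible S₂) :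
    IsRightAdmissible {X | triaClosure (S₁ ∪ S₂) X} := by
  refine ⟨isTriangulatedSub_triaClosure _, fun A ↦ ?_⟩
  obtain ⟨B₂, C, f, g, h, hA, hB₂, hC⟩ := h₂.2 A
  obtain ⟨B₁, C', γ, k, l, hT, hB₁, hC'⟩ := h₁.2 C
  obtain ⟨B, D, a, b, φ, q, r, hB, hD, hom_eq_zero⟩ := exists_triangle_of_hom_cone_eq_zero hA hT
  have hC'₂ : C' ∈ rightOrthogonal S₂ := fun X hX u ↦ by
    obtain ⟨v, rfl⟩ : ∃ v : X ⟶ C, u = v ≫ k := Triangle.coyoneda_exact₃ _ hT u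
      (horth hX (h₁.1.shift_mem _ 1 hB₁) _)
    rw [hC hX v, zero_comp]
  refine ⟨B, D, φ, q, r, hD, ?_, ?_⟩
  · exact .ext₂ _ hB (.of (Or.inr hB₂)) (.of (Or.inl hB₁))
  · refine mem_rightOrthogonal_triaClosure (h₁.1.shift_mem_union h₂.1) fun X hX ↦ ?_
    exact hom_eq_zero X (hX.elim (fun hX ↦ hC' hX) (fun hX ↦ hC'₂ hX))

lemma IsLeftAdmissible.triaClosure_union {S₁ S₂ : Set T} (horth : ZeroHoms S₂ S₁)
    (h₁ : IsLeftAdmissible S₁) (h₂ : IsLeftAdmissible S₂) :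
    IsLeftAdmissible {X | triaClosure (S₁ ∪ S₂) X} := by
  refine ⟨isTriangulatedSub_triaClosure _, fun A ↦ ?_⟩
  obtain ⟨B, C₁, f, g, h, hA, hB, hC₁⟩ := h₁.2 A
  obtain ⟨B', C₂, k, p, l, hT, hB', hC₂⟩ := h₂.2 B
  obtain ⟨D, E, a, b, e, φ, w, hD, hE, hom_eq_zero⟩ := exists_triangle_of_hom_fibre_eq_zero hA hT
  have hB'₁ : B' ∈ leftOrthogonal S₁ := fun Y hY u ↦ by
    obtain ⟨v, rfl⟩ : ∃ v : B ⟶ Y, u = k ≫ v := Triangle.yoneda_exact₂ _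
      (inv_rot_of_distTriang _ hT) u (horth (h₂.1.shift_mem _ (-1) hC₂) hY _)
    rw [hB hY v, comp_zero]
  refine ⟨E, D, e, φ, w, hE, ?_, ?_⟩
  · refine mem_leftOrthogonal_triaClosure (h₁.1.shift_mem_union h₂.1) fun Y hY ↦ ?_
    exact hom_eq_zero Y (hY.elim (fun hY ↦ hB'₁ hY) (fun hY ↦ hB' hY))
  · exact .ext₂ _ hD (.of (Or.inr hC₂)) (.of (Or.inl hC₁))

end SOD

open SOD

/-!
STATEMENT 17: the triangulated envelope of two semi-orthogonal right (resp. left)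
admissible subcategories is right (resp. left) admissible.
-/

theorem stmt17
    (S₁ S₂ : Set T) (horth : ZeroHoms S₂ S₁) :
    (IsRightAdmissible S₁ → IsRightAdmissible S₂ →
      IsRightAdmissible {X | triaClosure (S₁ ∪ S₂) X}) ∧
    (IsLeftAdmissible S₁ → IsLeftAdmissible S₂ →
      IsLeftAdmissible {X | triaClosure (S₁ ∪ S₂) X}) := by
  exact ⟨.triaClosure_union horth, .triaClosure_union horth⟩
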